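/- There exist constants c₁, c₂ > 0 and N ∈ ℕ such that for all n ≥ N the following holds: if w₀, w₁, …, w_n are independent standard Gaussian random variables N(0,1), and f : {−1,1}^n → {−1,1} is the random linear threshold function f(x) = sign(w₀ + Σ_{i=1}^n w_i x_i), then with probability at least 1 − e^{−c₂ n} over the choice of the weights, Inf(f) ≥ c₁·√n. -/

import Mathlib

open Finset Real MeasureTheory ProbabilityTheory
open scoped Classical

/-- sign: maps z to 1 if z > 0 and to −1 if z ≤ 0. -/
noncomputable def sgn (z : ℝ) : ℝ := if 0 < z then 1 else -1

/-- interpret a Bool as ±1. -/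
def pm (b : Bool) : ℝ := if b then 1 else -1

/-- probability of an event under the uniform distribution on {−1,1}^n. -/
noncomputable def unifPr (n : ℕ) (E : (Fin n → Bool) → Prop) : ℝ :=
  ((Finset.univ : Finset (Fin n → Bool)).filter E).card / 2 ^ n

/-- expectation under the uniform distribution on {−1,1}^n. -/
noncomputable def unifExp (n : ℕ) (g : (Fin n → Bool) → ℝ) : ℝ :=
  (∑ x : Fin n → Bool, g x) / 2 ^ n

/-- flip the i-th coordinate. -/
def flipAt {n : ℕ} (i : Fin n) (x : Fin n → Bool) : Fin n → Bool :=
  Function.update x i (!(x i))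

/-- influence of coordinate i. -/
noncomputable def infl {n : ℕ} (f : (Fin n → Bool) → ℝ) (i : Fin n) : ℝ :=
  unifPr n (fun x => f x ≠ f (flipAt i x))

/-- total influence. -/
noncomputable def totalInfl {n : ℕ} (f : (Fin n → Bool) → ℝ) : ℝ :=
  ∑ i, infl f i

/-- Fourier coefficient f̂(S). -/
noncomputable def fCoeff {n : ℕ} (f : (Fin n → Bool) → ℝ) (S : Finset (Fin n)) : ℝ :=
  unifExp n (fun x => f x * ∏ i ∈ S, pm (x i))

/-- Fourier entropy with log base 2 (0 · log(1/0) is 0 by convention, which holds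
definitionally since `Real.log 0 = 0` in Mathlib). -/
noncomputable def fourierEntropy {n : ℕ} (f : (Fin n → Bool) → ℝ) : ℝ :=
  ∑ S : Finset (Fin n), (fCoeff f S) ^ 2 * Real.logb 2 (1 / (fCoeff f S) ^ 2)

/-- The linear threshold function with weights w₀, w₁, …, w_n. -/
noncomputable def ltf (n : ℕ) (w : Fin (n + 1) → ℝ) : (Fin n → Bool) → ℝ :=
  fun x => sgn (w 0 + ∑ i : Fin n, w i.succ * pm (x i))

/-- linear form -/
noncomputable def linS {n : ℕ} (w : Fin n → ℝ) (x : Fin n → Bool) : ℝ := ∑ i, w i * pm (x i)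

lemma sum_cons_bool {n : ℕ} (F : (Fin (n+1) → Bool) → ℝ) :
    ∑ x, F x = ∑ x : Fin n → Bool, (F (Fin.cons true x) + F (Fin.cons false x)) := by
  rw [← (Fin.consEquiv (fun _ : Fin (n+1) => Bool)).sum_comp, Fintype.sum_prod_type,
    Fintype.sum_bool, Finset.sum_add_distrib]
  rfl

lemma linS_cons {n : ℕ} (w : Fin (n+1) → ℝ) (b : Bool) (x : Fin n → Bool) :
    linS w (Fin.cons b x) = w 0 * pm b + linS (fun i => w i.succ) x := by
  simp [linS, Fin.sum_univ_succ]

lemma linS_sq {n : ℕ} (w : Fin n → ℝ) : ∑ x, linS w x ^ 2 = 2 ^ n * ∑ i, w i ^ 2 := by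
  induction n with
  | zero => simp [linS]
  | succ n ih =>
    rw [sum_cons_bool]
    have : ∀ x : Fin n → Bool, linS w (Fin.cons true x) ^ 2 + linS w (Fin.cons false x) ^ 2
        = 2 * linS (fun i => w i.succ) x ^ 2 + 2 * w 0 ^ 2 := by
      intro x
      rw [linS_cons, linS_cons]; simp only [pm]; norm_num; ring
    simp only [this]
    rw [Finset.sum_add_distrib, ← Finset.mul_sum, ih, Fin.sum_univ_succ]
    simp
    ring

lemma linS_four {n : ℕ} (w : Fin n → ℝ) :
    ∑ x, linS w x ^ 4 ≤ 2 ^ n * (3 * (∑ i, w i ^ 2) ^ 2) := by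
  induction n with
  | zero => simp [linS]
  | succ n ih =>
    rw [sum_cons_bool]
    have : ∀ x : Fin n → Bool, linS w (Fin.cons true x) ^ 4 + linS w (Fin.cons false x) ^ 4
        = 2 * linS (fun i => w i.succ) x ^ 4 + 12 * w 0 ^ 2 * linS (fun i => w i.succ) x ^ 2
          + 2 * w 0 ^ 4 := by
      intro x
      rw [linS_cons, linS_cons]; simp only [pm]; norm_num; ring
    simp only [this]
    rw [Finset.sum_add_distrib, Finset.sum_add_distrib, ← Finset.mul_sum, ← Finset.mul_sum,
      linS_sq, Fin.sum_univ_succ]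
    have h := ih (fun i => w i.succ)
    simp only [Finset.sum_const, Finset.card_univ, Fintype.card_fun, Fintype.card_bool,
      Fintype.card_fin, nsmul_eq_mul]
    push_cast
    have h2 : (0:ℝ) ≤ 2 ^ n * w 0 ^ 4 := by positivity
    rw [pow_succ (2:ℝ) n]
    nlinarith

lemma khinchine {n : ℕ} (w : Fin n → ℝ) (s : ℝ) (hs : 0 < s) (h : s ^ 2 = ∑ i, w i ^ 2) :
    2 ^ n * (s / 2) ≤ ∑ x, |linS w x| := by
  have key : ∀ x, linS w x ^ 2 * s ^ 2 - linS w x ^ 4 / 6 ≤ s ^ 3 * |linS w x| := by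
    intro x
    have e2 : linS w x ^ 2 = |linS w x| ^ 2 := (sq_abs _).symm
    have e4 : linS w x ^ 4 = |linS w x| ^ 4 := by
      rw [show linS w x ^ 4 = (linS w x ^ 2) ^ 2 by ring, e2]; ring
    rw [e2, e4]
    have h0 := abs_nonneg (linS w x)
    generalize |linS w x| = y at *
    have : 0 ≤ s ^ 3 + y ^ 3 / 6 - y * s ^ 2 := by
      nlinarith [mul_nonneg (add_nonneg hs.le h0) (sq_nonneg (2 * y - 3 * s)), sq_nonneg (2 * y - 3 * s), mul_nonneg hs.le (sq_nonneg (2 * y - 3 * s)), mul_nonneg h0 (sq_nonneg (2 * y - 3 * s)), pow_pos hs 3, pow_nonneg h0 3]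
    nlinarith [mul_nonneg h0 this]
  have h1 := Finset.sum_le_sum (fun x (_ : x ∈ Finset.univ) => key x)
  rw [Finset.sum_sub_distrib, ← Finset.sum_mul, ← Finset.sum_div, ← Finset.mul_sum, linS_sq,
    ← h] at h1
  have h4 := linS_four w
  rw [← h] at h4
  have : s ^ 3 * (2 ^ n * (s / 2)) ≤ s ^ 3 * ∑ x, |linS w x| := by nlinarith
  exact le_of_mul_le_mul_left this (by positivity)

lemma linS_l1 {n : ℕ} (w : Fin n → ℝ) (r : ℝ) (hr : 0 < r) (h : ∑ i, w i ^ 2 ≤ r ^ 2) :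
    ∑ x, |linS w x| ≤ 2 ^ n * r := by
  have key : ∀ x, 2 * r * |linS w x| ≤ linS w x ^ 2 + r ^ 2 := by
    intro x
    rw [← sq_abs (linS w x)]
    nlinarith [sq_nonneg (|linS w x| - r)]
  have h1 := Finset.sum_le_sum (fun x (_ : x ∈ Finset.univ) => key x)
  rw [Finset.sum_add_distrib, ← Finset.mul_sum, linS_sq] at h1
  simp only [Finset.sum_const, Finset.card_univ, Fintype.card_fun, Fintype.card_bool,
      Fintype.card_fin, nsmul_eq_mul] at h1
  push_cast at h1
  have h2 : (2:ℝ) ^ n * ∑ i, w i ^ 2 ≤ 2 ^ n * r ^ 2 := by gcongr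
  have : (2 * r) * ∑ x, |linS w x| ≤ (2 * r) * (2 ^ n * r) := by nlinarith
  exact le_of_mul_le_mul_left this (by positivity)

lemma flipAt_flipAt {n : ℕ} (i : Fin n) (x : Fin n → Bool) : flipAt i (flipAt i x) = x := by
  simp [flipAt]

lemma abs_pm (b : Bool) : |pm b| = 1 := by cases b <;> simp [pm]

lemma coeff_le_infl {n : ℕ} (f : (Fin n → Bool) → ℝ) (hf : ∀ x, |f x| ≤ 1) (i : Fin n) :
    |∑ x, f x * pm (x i)| ≤ 2 ^ n * infl f i := by
  have h1 : ∑ x, f x * pm (x i) = ∑ x, f (flipAt i x) * pm (flipAt i x i) := by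
    have hinv : Function.Involutive (flipAt i) := flipAt_flipAt i
    exact (Equiv.sum_comp hinv.toPerm (fun x => f x * pm (x i))).symm
  have h2 : ∀ x : Fin n → Bool, pm (flipAt i x i) = - pm (x i) := by
    intro x
    simp only [flipAt, Function.update_self]
    cases x i <;> simp [pm]
  simp only [h2] at h1
  have h3 : 2 * ∑ x, f x * pm (x i) = ∑ x, (f x - f (flipAt i x)) * pm (x i) := by
    rw [two_mul]
    nth_rewrite 2 [h1]
    rw [← Finset.sum_add_distrib]
    exact Finset.sum_congr rfl fun x _ => by ring
  have h4 : |∑ x, (f x - f (flipAt i x)) * pm (x i)|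
      ≤ ∑ x, (if f x ≠ f (flipAt i x) then (2:ℝ) else 0) := by
    refine (Finset.abs_sum_le_sum_abs _ _).trans (Finset.sum_le_sum fun x _ => ?_)
    rw [abs_mul, abs_pm, mul_one]
    split_ifs with hne
    · exact (abs_sub _ _).trans (by linarith [hf x, hf (flipAt i x)])
    · push Not at hne; simp [hne]
  rw [← h3, abs_mul, abs_two, ← Finset.sum_filter, Finset.sum_const, nsmul_eq_mul] at h4
  unfold infl unifPr
  rw [mul_div_cancel₀ _ (by positivity)]
  refine le_trans (le_of_mul_le_mul_left (h4.trans_eq (mul_comm _ _)) two_pos) (le_of_eq ?_)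
  congr!

lemma infl_nonneg {n : ℕ} (f : (Fin n → Bool) → ℝ) (i : Fin n) : 0 ≤ infl f i := by
  unfold infl unifPr; positivity

lemma corr_le {n : ℕ} (f : (Fin n → Bool) → ℝ) (hf : ∀ x, |f x| ≤ 1) (v : Fin n → ℝ) (T : ℝ)
    (hv : ∀ i, |v i| ≤ T) : ∑ x, f x * linS v x ≤ 2 ^ n * (T * totalInfl f) := by
  have : ∑ x, f x * linS v x = ∑ i, v i * ∑ x, f x * pm (x i) := by
    simp only [linS, Finset.mul_sum]
    rw [Finset.sum_comm]
    exact Finset.sum_congr rfl fun x _ => Finset.sum_congr rfl fun x _ => by ring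
  rw [this, totalInfl, Finset.mul_sum, Finset.mul_sum]
  refine Finset.sum_le_sum fun i _ => (le_abs_self _).trans ?_
  rw [abs_mul]
  have := coeff_le_infl f hf i
  calc _ ≤ T * (2 ^ n * infl f i) :=
        mul_le_mul (hv i) this (abs_nonneg _) ((abs_nonneg _).trans (hv i))
    _ = _ := by ring

lemma abs_sgn (z : ℝ) : |sgn z| = 1 := by unfold sgn; split_ifs <;> simp

lemma sgn_mul (z : ℝ) : sgn z * z = |z| := by
  unfold sgn; split_ifs with h
  · rw [abs_of_pos h, one_mul]
  · rw [abs_of_nonpos (not_lt.1 h)]; ring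

/-- truncation to large values -/
noncomputable def big (T z : ℝ) : ℝ := if T < |z| then z else 0

lemma det_bound {n : ℕ} (hn : 0 < n) (w : Fin (n+1) → ℝ) (b T : ℝ) (hb : 0 < b) (hT : 0 < T)
    (h0 : |w 0| ≤ b / 12 * √n) (h1 : b ^ 2 * n ≤ ∑ i : Fin n, w i.succ ^ 2)
    (h2 : ∑ i : Fin n, big T (w i.succ) ^ 2 ≤ (b / 12) ^ 2 * n) :
    b / (4 * T) * √n ≤ totalInfl (ltf n w) := by
  have hn' : (0:ℝ) < n := by exact_mod_cast hn
  have hsn : 0 < √(n:ℝ) := Real.sqrt_pos.2 hn'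
  have hsq : √(n:ℝ) ^ 2 = n := Real.sq_sqrt hn'.le
  set u : Fin n → ℝ := fun i => w i.succ with hu
  set v : Fin n → ℝ := fun i => big T (w i.succ) with hvd
  set f := ltf n w with hfd
  have hf : ∀ x, |f x| ≤ 1 := fun x => (abs_sgn _).le
  set s := √(∑ i, u i ^ 2) with hs
  have hsb : b * √n ≤ s := by
    apply Real.le_sqrt_of_sq_le
    rw [mul_pow, hsq]; exact h1
  have hspos : 0 < s := lt_of_lt_of_le (by positivity) hsb
  have hk := khinchine u s hspos (Real.sq_sqrt (Finset.sum_nonneg fun i _ => sq_nonneg _))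
  have hl := linS_l1 v (b / 12 * √n) (by positivity) (by rw [mul_pow, hsq]; exact h2)
  have hc := corr_le f hf (fun i => u i - v i) T (by
    intro i
    simp only [hu, hvd, big]
    split_ifs with h
    · simpa using hT.le
    · simpa using not_lt.1 h)
  have hp : ∀ x, |linS u x| - |linS v x| - 2 * |w 0| ≤ f x * linS (fun i => u i - v i) x := by
    intro x
    have e : linS (fun i => u i - v i) x = linS u x - linS v x := by
      simp [linS, sub_mul, Finset.sum_sub_distrib]
    have e1 : f x * (w 0 + linS u x) = |w 0 + linS u x| := sgn_mul _
    have e2 : |linS u x| ≤ |w 0 + linS u x| + |w 0| := by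
      have := abs_sub (w 0 + linS u x) (w 0)
      rwa [add_sub_cancel_left] at this
    have e3 : f x * w 0 ≤ |w 0| := by
      refine (le_abs_self _).trans ?_
      rw [abs_mul]; exact mul_le_of_le_one_left (abs_nonneg _) (hf x)
    have e4 : f x * linS v x ≤ |linS v x| := by
      refine (le_abs_self _).trans ?_
      rw [abs_mul]; exact mul_le_of_le_one_left (abs_nonneg _) (hf x)
    rw [e]
    linarith
  have h3 := Finset.sum_le_sum (fun x (_ : x ∈ Finset.univ) => hp x)
  rw [Finset.sum_sub_distrib, Finset.sum_sub_distrib] at h3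
  simp only [Finset.sum_const, Finset.card_univ, Fintype.card_fun, Fintype.card_bool,
      Fintype.card_fin, nsmul_eq_mul] at h3
  push_cast at h3
  have h2n : (0:ℝ) < 2 ^ n := by positivity
  have : (2:ℝ) ^ n * (b / 4 * √n) ≤ 2 ^ n * (T * totalInfl f) := by
    have : (2:ℝ) ^ n * (b / 4 * √n) ≤ 2 ^ n * (s / 2 - b / 12 * √n - 2 * |w 0|) := by
      apply mul_le_mul_of_nonneg_left _ h2n.le
      linarith
    linarith
  have := le_of_mul_le_mul_left this h2n
  rw [show b / (4 * T) * √n = (b / 4 * √n) / T by field_simp, div_le_iff₀ hT]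
  linarith

lemma chern {n : ℕ} (F : Fin n → ℝ → ℝ) (h0 : ∀ i z, 0 ≤ F i z)
    (hi : ∀ i, Integrable (F i) (gaussianReal 0 1)) :
    (Measure.pi fun _ : Fin n => gaussianReal 0 1).real {w | 1 ≤ ∏ i, F i (w i)}
      ≤ ∏ i, ∫ z, F i z ∂(gaussianReal 0 1) := by
  have h := mul_meas_ge_le_integral_of_nonneg
    (μ := Measure.pi fun _ : Fin n => gaussianReal 0 1) (f := fun w => ∏ i, F i (w i))
    (ae_of_all _ fun w => Finset.prod_nonneg fun i _ => h0 i _)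
    (Integrable.fintype_prod hi) 1
  rw [integral_fintype_prod_eq_prod, one_mul] at h
  exact h

lemma chern_tail {n : ℕ} (g : ℝ → ℝ) (t : ℝ)
    (hi : Integrable (fun z => rexp (g z - t)) (gaussianReal 0 1)) :
    (Measure.pi fun _ : Fin (n+1) => gaussianReal 0 1).real {w | t * n ≤ ∑ i : Fin n, g (w i.succ)}
      ≤ (∫ z, rexp (g z - t) ∂(gaussianReal 0 1)) ^ n := by
  have := chern (n := n+1) (Fin.cons (fun _ => 1) (fun _ z => rexp (g z - t))) (by
    intro i z
    refine Fin.cases ?_ (fun i => ?_) i <;> simp [Real.exp_nonneg]) (by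
    intro i
    refine Fin.cases ?_ (fun i => ?_) i
    · simp
    · simpa using hi)
  rw [Fin.prod_univ_succ] at this
  simp only [Fin.cons_zero, Fin.cons_succ, integral_const, probReal_univ, smul_eq_mul, mul_one,
    one_mul, Finset.prod_const, Finset.card_univ, Fintype.card_fin] at this
  refine le_trans (measureReal_mono ?_) this
  intro w hw
  simp only [Set.mem_ofPred_eq] at hw ⊢
  rw [Fin.prod_univ_succ]
  simp only [Fin.cons_zero, Fin.cons_succ, one_mul]
  rw [← Real.exp_sum, Finset.sum_sub_distrib]
  apply Real.one_le_exp
  simp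
  linarith

lemma chern_zero {n : ℕ} (g : ℝ → ℝ) (t : ℝ)
    (hi : Integrable (fun z => rexp (g z)) (gaussianReal 0 1)) :
    (Measure.pi fun _ : Fin (n+1) => gaussianReal 0 1).real {w | t ≤ g (w 0)}
      ≤ rexp (-t) * ∫ z, rexp (g z) ∂(gaussianReal 0 1) := by
  have := chern (n := n+1) (Fin.cons (fun z => rexp (-t) * rexp (g z)) (fun _ _ => 1)) (by
    intro i z
    refine Fin.cases ?_ (fun i => ?_) i
    · simp only [Fin.cons_zero]; positivity
    · simp) (by
    intro i
    refine Fin.cases ?_ (fun i => ?_) i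
    · simpa using hi.const_mul _
    · simp)
  rw [Fin.prod_univ_succ] at this
  simp only [Fin.cons_zero, Fin.cons_succ, integral_const, probReal_univ, smul_eq_mul, mul_one,
    one_mul, Finset.prod_const_one, integral_const_mul] at this
  refine le_trans (measureReal_mono ?_) this
  intro w hw
  simp only [Set.mem_ofPred_eq] at hw ⊢
  rw [Fin.prod_univ_succ]
  simp only [Fin.cons_zero, Fin.cons_succ, Finset.prod_const_one, mul_one]
  rw [← Real.exp_add]
  apply Real.one_le_exp
  linarith

lemma lower_const : ∃ b : ℝ, 0 < b ∧ ∃ c : ℝ, 0 < c ∧ ∀ n : ℕ,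
    (Measure.pi fun _ : Fin (n+1) => gaussianReal 0 1).real
      {w | ¬ b ^ 2 * n ≤ ∑ i : Fin n, w i.succ ^ 2} ≤ rexp (-c * n) := by
  have hint : Integrable (fun z : ℝ => rexp (-z ^ 2)) (gaussianReal 0 1) := by
    refine Integrable.of_bound (C := 1) (by fun_prop) (ae_of_all _ fun z => ?_)
    rw [Real.norm_eq_abs, Real.abs_exp]
    exact Real.exp_le_one_iff.2 (by nlinarith [sq_nonneg z])
  set q := ∫ z : ℝ, rexp (-z ^ 2) ∂(gaussianReal 0 1) with hq
  have hq0 : 0 < q := integral_exp_pos hint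
  have hq1 : q < 1 := by
    have : 0 < ∫ z : ℝ, (1 - rexp (-z ^ 2)) ∂(gaussianReal 0 1) := by
      rw [integral_pos_iff_support_of_nonneg]
      · have hsup : Function.support (fun z : ℝ => 1 - rexp (-z ^ 2)) = {0}ᶜ := by
          ext z
          rw [Function.mem_support, ne_eq, sub_eq_zero, eq_comm, Real.exp_eq_one_iff]
          simp
        rw [hsup]
        have hna := nullSingletonClass_gaussianReal (μ := 0) (v := 1) (by norm_num)
        rw [prob_compl_eq_one_sub (by measurability)]
        rw [measure_singleton]; simp
      · intro z
        simp only [Pi.zero_apply, sub_nonneg]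
        exact Real.exp_le_one_iff.2 (by nlinarith [sq_nonneg z])
      · exact (integrable_const _).sub hint
    rw [integral_sub (integrable_const _) hint] at this
    simp at this
    exact this
  have hlog : Real.log q < 0 := Real.log_neg hq0 hq1
  refine ⟨√(-Real.log q / 2), Real.sqrt_pos.2 (by linarith), -Real.log q / 2, by linarith, ?_⟩
  intro n
  rw [Real.sq_sqrt (by linarith)]
  have e : ∀ z : ℝ, rexp (-z ^ 2 - Real.log q / 2) = rexp (-Real.log q / 2) * rexp (-z ^ 2) := by
    intro z; rw [← Real.exp_add]; congr 1; ring
  have h := chern_tail (n := n) (fun z => -z ^ 2) (Real.log q / 2) (by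
    simp only [e]; exact hint.const_mul _)
  simp only [e, integral_const_mul] at h
  rw [← hq] at h
  have e2 : rexp (-Real.log q / 2) * q = rexp (Real.log q / 2) := by
    nth_rewrite 2 [← Real.exp_log hq0]
    rw [← Real.exp_add]; congr 1; ring
  rw [e2, ← Real.exp_nat_mul] at h
  refine le_trans (measureReal_mono ?_) (h.trans (le_of_eq ?_))
  · intro w hw
    simp only [Set.mem_ofPred_eq, Finset.sum_neg_distrib] at hw ⊢
    linarith
  · congr 1; ring

lemma gauss_exp : ∃ C : ℝ, 0 < C ∧ Integrable (fun z : ℝ => rexp (C * z ^ 2)) (gaussianReal 0 1) := by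
  obtain ⟨C, hC, h⟩ := IsGaussian.exists_integrable_exp_sq (gaussianReal 0 1)
  refine ⟨C, hC, ?_⟩
  simpa using h

lemma zero_tail (C : ℝ) (hC : 0 < C)
    (hi : Integrable (fun z : ℝ => rexp (C * z ^ 2)) (gaussianReal 0 1)) (d : ℝ) (hd : 0 < d) (n : ℕ) :
    (Measure.pi fun _ : Fin (n+1) => gaussianReal 0 1).real
      {w | ¬ |w 0| ≤ d * √n} ≤
      (∫ z : ℝ, rexp (C * z ^ 2) ∂(gaussianReal 0 1)) * rexp (-(C * d ^ 2) * n) := by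
  have h := chern_zero (n := n) (fun z => C * z ^ 2) (C * d ^ 2 * n) hi
  rw [mul_comm (rexp _)] at h
  rw [neg_mul]
  refine le_trans (measureReal_mono ?_) h
  intro w hw
  simp only [Set.mem_ofPred_eq, not_le] at hw ⊢
  have : (d * √n) ^ 2 ≤ |w 0| ^ 2 := by gcongr
  rw [sq_abs, mul_pow, Real.sq_sqrt (by positivity)] at this
  rw [mul_assoc]
  gcongr

lemma big_tail (C : ℝ) (hC : 0 < C)
    (hi : Integrable (fun z : ℝ => rexp (C * z ^ 2)) (gaussianReal 0 1)) (d : ℝ) (hd : 0 < d) :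
    ∃ T : ℝ, 0 < T ∧ ∀ n : ℕ,
    (Measure.pi fun _ : Fin (n+1) => gaussianReal 0 1).real
      {w | ¬ ∑ i : Fin n, big T (w i.succ) ^ 2 ≤ d ^ 2 * n} ≤ rexp (-(C * d ^ 2 / 4) * n) := by
  set K := ∫ z : ℝ, rexp (C * z ^ 2) ∂(gaussianReal 0 1) with hK
  have hK0 : 0 < K := integral_exp_pos hi
  have hlim : Filter.Tendsto (fun T : ℝ => K * rexp (-(C * T ^ 2 / 2))) Filter.atTop (nhds 0) := by
    rw [← mul_zero K]
    refine Filter.Tendsto.const_mul _ (Real.tendsto_exp_neg_atTop_nhds_zero.comp ?_)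
    refine Filter.Tendsto.atTop_div_const (by norm_num) ?_
    exact Filter.Tendsto.const_mul_atTop hC (Filter.tendsto_pow_atTop (by norm_num))
  have hpos : 0 < C * d ^ 2 / 4 := by positivity
  obtain ⟨T, hT, hT0⟩ := ((hlim.eventually_lt_const hpos).and (Filter.eventually_gt_atTop 0)).exists
  refine ⟨T, hT0, fun n => ?_⟩
  have hmb : Measurable (big T) := by
    unfold big
    exact Measurable.ite (measurableSet_lt measurable_const measurable_id.abs) measurable_id
      measurable_const
  have hle : ∀ z, rexp (C / 2 * big T z ^ 2) ≤ 1 + rexp (-(C * T ^ 2 / 2)) * rexp (C * z ^ 2) := by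
    intro z
    unfold big
    split_ifs with h
    · rw [← Real.exp_add]
      have h2 : T ^ 2 ≤ |z| ^ 2 := by gcongr
      rw [sq_abs] at h2
      have : rexp (C / 2 * z ^ 2) ≤ rexp (-(C * T ^ 2 / 2) + C * z ^ 2) := by
        apply Real.exp_le_exp.2
        nlinarith
      linarith
    · simp; positivity
  have hi1 : Integrable (fun z => 1 + rexp (-(C * T ^ 2 / 2)) * rexp (C * z ^ 2))
      (gaussianReal 0 1) := (integrable_const _).add (hi.const_mul _)
  have hi2 : Integrable (fun z => rexp (C / 2 * big T z ^ 2)) (gaussianReal 0 1) := by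
    refine hi1.mono' ?_ (ae_of_all _ fun z => ?_)
    · exact (Real.measurable_exp.comp ((hmb.pow_const 2).const_mul _)).aestronglyMeasurable
    · rw [Real.norm_eq_abs, Real.abs_exp]; exact hle z
  have hI : ∫ z, rexp (C / 2 * big T z ^ 2) ∂(gaussianReal 0 1) ≤ rexp (C * d ^ 2 / 4) := by
    refine (integral_mono hi2 hi1 hle).trans ?_
    rw [integral_add (integrable_const _) (hi.const_mul _), integral_const_mul, ← hK]
    simp only [integral_const, probReal_univ, smul_eq_mul, mul_one]
    refine le_trans ?_ (Real.add_one_le_exp _)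
    linarith
  have e : ∀ z : ℝ, rexp (C / 2 * big T z ^ 2 - C / 2 * d ^ 2)
      = rexp (-(C / 2 * d ^ 2)) * rexp (C / 2 * big T z ^ 2) := by
    intro z; rw [← Real.exp_add]; congr 1; ring
  have h := chern_tail (n := n) (fun z => C / 2 * big T z ^ 2) (C / 2 * d ^ 2) (by
    simp only [e]; exact hi2.const_mul _)
  simp only [e, integral_const_mul] at h
  refine le_trans (measureReal_mono ?_) (h.trans ?_)
  · intro w hw
    simp only [Set.mem_ofPred_eq, not_le, ← Finset.mul_sum] at hw ⊢
    rw [mul_assoc]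
    gcongr
  · have : rexp (-(C / 2 * d ^ 2)) * ∫ z, rexp (C / 2 * big T z ^ 2) ∂(gaussianReal 0 1)
        ≤ rexp (-(C * d ^ 2 / 4)) := by
      calc _ ≤ rexp (-(C / 2 * d ^ 2)) * rexp (C * d ^ 2 / 4) := by gcongr
        _ = _ := by rw [← Real.exp_add]; congr 1; ring
    calc _ ≤ rexp (-(C * d ^ 2 / 4)) ^ n := by
          apply pow_le_pow_left₀ _ this
          exact mul_nonneg (Real.exp_nonneg _) (integral_nonneg fun z => Real.exp_nonneg _)
      _ = _ := by rw [← Real.exp_nat_mul]; congr 1; ring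

/-- a random LTF with i.i.d. standard Gaussian weights has influence
Ω(√n) with probability 1 − e^{−Ω(n)}. -/
theorem random_gaussian_ltf_influence :
    ∃ c₁ c₂ : ℝ, 0 < c₁ ∧ 0 < c₂ ∧ ∃ N : ℕ, ∀ n : ℕ, N ≤ n →
      (Measure.pi fun _ : Fin (n + 1) => gaussianReal 0 1)
          {w : Fin (n + 1) → ℝ | c₁ * Real.sqrt n ≤ totalInfl (ltf n w)} ≥
        ENNReal.ofReal (1 - Real.exp (-c₂ * n)) := by
  obtain ⟨b, hb, c, hc, hlow⟩ := lower_const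
  obtain ⟨C, hC, hi⟩ := gauss_exp
  have hd : 0 < b / 12 := by positivity
  obtain ⟨T, hT, hbig⟩ := big_tail C hC hi (b / 12) hd
  have hzero := zero_tail C hC hi (b / 12) hd
  set K := ∫ z : ℝ, rexp (C * z ^ 2) ∂(gaussianReal 0 1) with hK
  have hK0 : 0 < K := integral_exp_pos hi
  set e := min c (C * (b / 12) ^ 2 / 4) with he
  have he0 : 0 < e := lt_min hc (by positivity)
  have hec : e ≤ c := min_le_left _ _
  have heC : e ≤ C * (b / 12) ^ 2 / 4 := min_le_right _ _
  have heC' : e ≤ C * (b / 12) ^ 2 := heC.trans (by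
    have : 0 < C * (b / 12) ^ 2 := by positivity
    linarith)
  obtain ⟨N, hN⟩ := exists_nat_ge ((K + 2) / (e / 2))
  refine ⟨b / (4 * T), e / 2, by positivity, by positivity, max N 1, fun n hn => ?_⟩
  have hn1 : 0 < n := lt_of_lt_of_le one_pos ((le_max_right _ _).trans hn)
  have hnN : (N:ℝ) ≤ n := by exact_mod_cast (le_max_left _ _).trans hn
  have hn0 : (0:ℝ) ≤ n := by positivity
  set μ := (Measure.pi fun _ : Fin (n + 1) => gaussianReal 0 1) with hμ
  set A := {w : Fin (n + 1) → ℝ | b / (4 * T) * Real.sqrt n ≤ totalInfl (ltf n w)} with hA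
  have hl := hlow n
  have hz := hzero n
  have hg := hbig n
  rw [← hμ] at hl hz hg
  set B1 := {w : Fin (n + 1) → ℝ | ¬ |w 0| ≤ b / 12 * √n} with hB1
  set B2 := {w : Fin (n + 1) → ℝ | ¬ b ^ 2 * n ≤ ∑ i : Fin n, w i.succ ^ 2} with hB2
  set B3 := {w : Fin (n + 1) → ℝ | ¬ ∑ i : Fin n, big T (w i.succ) ^ 2 ≤ (b / 12) ^ 2 * n} with hB3
  have hcov : (Set.univ : Set (Fin (n+1) → ℝ)) ⊆ A ∪ (B1 ∪ (B2 ∪ B3)) := by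
    intro w _
    by_cases h1 : w ∈ B1
    · simp [h1]
    by_cases h2 : w ∈ B2
    · simp [h2]
    by_cases h3 : w ∈ B3
    · simp [h3]
    left
    simp only [hB1, hB2, hB3, Set.mem_ofPred_eq, not_not] at h1 h2 h3
    exact det_bound hn1 w b T hb hT h1 h2 h3
  have h1 : (1:ℝ) ≤ μ.real A + (μ.real B1 + (μ.real B2 + μ.real B3)) := by
    have := measureReal_mono (μ := μ) hcov
    rw [probReal_univ] at this
    have a1 := measureReal_union_le (μ := μ) A (B1 ∪ (B2 ∪ B3))
    have a2 := measureReal_union_le (μ := μ) B1 (B2 ∪ B3)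
    have a3 := measureReal_union_le (μ := μ) B2 B3
    linarith
  have b1 : rexp (-c * n) ≤ rexp (-e * n) := by gcongr
  have b2 : rexp (-(C * (b / 12) ^ 2 / 4) * n) ≤ rexp (-e * n) := by gcongr
  have b3 : K * rexp (-(C * (b / 12) ^ 2) * n) ≤ K * rexp (-e * n) := by gcongr
  have hKe : K + 2 ≤ rexp (e / 2 * n) := by
    have : K + 2 ≤ e / 2 * n := by
      have := hN.trans hnN
      rw [div_le_iff₀ (by positivity)] at this
      linarith
    linarith [Real.add_one_le_exp (e / 2 * n)]
  have b4 : (K + 2) * rexp (-e * n) ≤ rexp (-(e / 2) * n) := by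
    calc _ ≤ rexp (e / 2 * n) * rexp (-e * n) := by gcongr
      _ = _ := by rw [← Real.exp_add]; congr 1; ring
  show ENNReal.ofReal _ ≤ μ A
  rw [ENNReal.ofReal_le_iff_le_toReal (measure_ne_top _ _)]
  change _ ≤ μ.real A
  linarith
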